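/- Let X ⊂ ℝ^d be finite with |X| = n, let C = {C_1,…,C_k} = SingleLinkage(X,k) and C′ = {C′_1,…,C′_k} = SingleLinkage(X_m,k) for a random subsample X_m of m points drawn uniformly with replacement from X. Let E be the event that C′ is inconsistent with C, i.e., there exists i such that C′_i ⊄ C_j for every j ∈ [k]. Then P[E] ≤ (kn)³·exp(−m/(n·ζ_{k,SL}(X))). -/

import Mathlib

open scoped Classical
open Real

noncomputable section

variable {P : Type*} [MetricSpace P]

/-- The maximum distance between consecutive points of a list (`0` for lists of length `≤ 1`). -/
def pathCost (p : List P) : ℝ := ((p.zip p.tail).map fun q => dist q.1 q.2).foldr max 0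

/-- Min-max (bottleneck) distance between `x` and `y` within the finite set `X`. -/
def minMaxD (X : Finset P) (x y : P) : ℝ :=
  sInf { r | ∃ p : List P, p ≠ [] ∧ p.Nodup ∧ (∀ a ∈ p, a ∈ X) ∧
    p.head? = some x ∧ p.getLast? = some y ∧ r = pathCost p }

/-- `d_MM(S; X) = max_{x,y ∈ S} d_MM(x,y;X)`. -/
def minMaxSet (X : Finset P) (S : Set P) : ℝ :=
  sSup { r | ∃ x ∈ S, ∃ y ∈ S, r = minMaxD X x y }

/-- One merge step of single linkage at distance threshold `D`. -/
def SLStep (X : Finset P) (D : ℝ) (a b : P) : Prop := a ∈ X ∧ b ∈ X ∧ dist a b ≤ D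

/-- Two points lie in a common single-linkage cluster at distance threshold `D`. -/
def SLLinked (X : Finset P) (D : ℝ) : P → P → Prop := Relation.ReflTransGen (SLStep X D)

/-- The merge distance at iteration `i` of single linkage on `X`. -/
def mergeDist (X : Finset P) : ℕ → ℝ
  | 0 => 0
  | (i+1) => sInf { r | ∃ x ∈ X, ∃ y ∈ X, ¬ SLLinked X (mergeDist X i) x y ∧ r = dist x y }

/-- The clusters of single linkage on `X` at distance threshold `D`. -/
def clustersAt (X : Finset P) (D : ℝ) : Set (Set P) :=
  { C | ∃ x ∈ X, C = { y | y ∈ X ∧ SLLinked X D x y } }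

/-- `C` is the `k`-clustering output by SingleLinkage(X,k). -/
def IsSLClustering (X : Finset P) (k : ℕ) (C : Set (Set P)) : Prop :=
  ∃ ℓ : ℕ, C = clustersAt X (mergeDist X ℓ) ∧ C.ncard = k

/-- The output of SingleLinkage(X,k): the clusters at the first iteration at which exactly `k`
clusters remain (junk value `∅` if no iteration leaves exactly `k` clusters). -/
def SLClusters (X : Finset P) (k : ℕ) : Set (Set P) :=
  if h : ∃ ℓ : ℕ, (clustersAt X (mergeDist X ℓ)).ncard = k then
    clustersAt X (mergeDist X (Nat.find h))
  else ∅

/-- `ζ_{k,SL}(X)`, expressed relative to an enumeration `C` of the single-linkage clusters. -/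
def zetaSL {k : ℕ} (X : Finset P) (C : Fin k → Set P) : ℝ :=
  (X.card : ℝ) *
    ((⌈(sInf { r | ∃ i j : Fin k, i ≠ j ∧ r = minMaxSet X (C i ∪ C j) } -
        sSup { r | ∃ t : Fin k, r = minMaxSet X (C t) }) /
        sSup { r | ∃ t : Fin k, r = minMaxSet X (C t) }⌉ : ℝ))⁻¹

/-- The cost `cost(C;G)` of a `k`-clustering `C` of `S` with respect to a ground-truth
`k`-clustering `G` of `X`:
`(1/|S|)·min_{σ ∈ Sym([k])} #{x ∈ S : ∃ j, x ∈ C_{σ(j)} ∧ x ∉ G_j}`, where the minimum also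
ranges over enumerations of the unindexed family `C`. -/
def costSet {k : ℕ} (S : Finset P) (C : Set (Set P)) (Gt : Fin k → Set P) : ℝ :=
  (S.card : ℝ)⁻¹ *
    sInf { c : ℝ | ∃ f : Fin k → Set P, Function.Injective f ∧ Set.range f = C ∧
      ∃ σ : Equiv.Perm (Fin k),
        c = ({ x ∈ (S : Set P) | ∃ j, x ∈ f (σ j) ∧ x ∉ Gt j }.ncard : ℝ) }

/-- `Gt` is a ground-truth `k`-clustering of `X`: a partition of `X` into `k` disjoint subsets. -/
def IsGroundTruth {k : ℕ} (X : Finset P) (Gt : Fin k → Set P) : Prop :=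
  (∀ i, Gt i ⊆ ↑X) ∧ Pairwise (fun i j => Disjoint (Gt i) (Gt j)) ∧ (⋃ i, Gt i) = ↑X

/-- The set of points appearing in a sample `ω` of `m` draws from `X`. -/
def sampleFinset {m : ℕ} (X : Finset P) (ω : Fin m → {x // x ∈ X}) : Finset P :=
  Finset.image (fun i => (ω i : P)) Finset.univ

/-- Probability of an event under the uniform distribution on a finite type. -/
def unifProb {α : Type*} [Fintype α] (E : Set α) : ℝ :=
  ((Finset.univ.filter fun a => a ∈ E).card : ℝ) / (Fintype.card α : ℝ)

section SingleLinkage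

lemma pathCost_nonneg (p : List P) : 0 ≤ pathCost p := by
  have h : ∀ l : List ℝ, 0 ≤ l.foldr max 0 := by
    intro l
    induction l with
    | nil => simp
    | cons a l ih => exact le_max_of_le_right ih
  exact h _

lemma pathCost_cons_cons (a b : P) (l : List P) :
    pathCost (a :: b :: l) = max (dist a b) (pathCost (b :: l)) := rfl

lemma pathCost_le_iff {D : ℝ} (hD : 0 ≤ D) (p : List P) :
    pathCost p ≤ D ↔ p.IsChain (fun a b => dist a b ≤ D) := by
  induction p with
  | nil => simpa [pathCost] using hD
  | cons a p ih =>
    cases p with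
    | nil => simpa [pathCost] using hD
    | cons b l => rw [pathCost_cons_cons, max_le_iff, ih, List.isChain_cons_cons]

lemma pathCost_mem {X : Finset P} (p : List P) (hp : ∀ a ∈ p, a ∈ X) :
    pathCost p ∈ insert (0 : ℝ) ((X ×ˢ X).image fun q => dist q.1 q.2) := by
  induction p with
  | nil => simp [pathCost]
  | cons a p ih =>
    cases p with
    | nil => simp [pathCost]
    | cons b l =>
      rw [pathCost_cons_cons]
      rcases max_choice (dist a b) (pathCost (b :: l)) with h | h <;> rw [h]
      · refine Finset.mem_insert_of_mem (Finset.mem_image.2 ⟨(a, b), ?_, rfl⟩)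
        exact Finset.mem_product.2 ⟨hp a (by simp), hp b (by simp)⟩
      · exact ih fun c hc => hp c (List.mem_cons_of_mem _ hc)

lemma SLStep.symm {X : Finset P} {D : ℝ} {a b : P} (h : SLStep X D a b) : SLStep X D b a :=
  ⟨h.2.1, h.1, by rw [dist_comm]; exact h.2.2⟩

lemma SLLinked.symm {X : Finset P} {D : ℝ} {a b : P} (h : SLLinked X D a b) :
    SLLinked X D b a :=
  have : Std.Symm (SLStep X D) := ⟨fun _ _ => SLStep.symm⟩
  Relation.ReflTransGen.stdSymm.symm _ _ h

lemma SLLinked.mono {X Y : Finset P} {D E : ℝ} (hXY : X ⊆ Y) (hDE : D ≤ E) {a b : P}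
    (h : SLLinked X D a b) : SLLinked Y E a b :=
  Relation.ReflTransGen.mono (fun _ _ h => ⟨hXY h.1, hXY h.2.1, h.2.2.trans hDE⟩) _ _ h

lemma SLLinked.single {X : Finset P} {D : ℝ} {a b : P} (ha : a ∈ X) (hb : b ∈ X)
    (h : dist a b ≤ D) : SLLinked X D a b :=
  Relation.ReflTransGen.single ⟨ha, hb, h⟩

/-- The graph on `X` joining distinct points at distance at most `D`. -/
def thresholdGraph (X : Finset P) (D : ℝ) : SimpleGraph P where
  Adj a b := a ≠ b ∧ SLStep X D a b
  symm := ⟨fun _ _ h => ⟨h.1.symm, h.2.symm⟩⟩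
  loopless := ⟨fun _ h => h.1 rfl⟩

lemma thresholdGraph_reachable_iff {X : Finset P} {D : ℝ} {a b : P} :
    (thresholdGraph X D).Reachable a b ↔ SLLinked X D a b := by
  rw [SimpleGraph.reachable_iff_reflTransGen]
  refine ⟨Relation.ReflTransGen.mono (fun _ _ h => h.2) _ _, fun h => ?_⟩
  induction h with
  | refl => exact .refl
  | @tail b c _ h ih =>
    by_cases hbc : b = c
    · exact hbc ▸ ih
    · exact ih.tail ⟨hbc, h⟩

lemma thresholdGraph_support_subset {X : Finset P} {D : ℝ} {a b : P} (ha : a ∈ X)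
    (p : (thresholdGraph X D).Walk a b) : ∀ c ∈ p.support, c ∈ X := by
  induction p with
  | nil => simpa using ha
  | cons h p ih => simpa using ⟨ha, ih h.2.2.1⟩

lemma thresholdGraph_dist_le {X : Finset P} {D : ℝ} {a b : P}
    (p : (thresholdGraph X D).Walk a b) : dist a b ≤ p.length * D := by
  induction p with
  | nil => simp
  | @cons a c b h p ih =>
    have h1 := dist_triangle a c b
    have h2 := h.2.2.2
    rw [SimpleGraph.Walk.length_cons]
    push_cast
    linarith

lemma minMaxD_nonneg (X : Finset P) (x y : P) : 0 ≤ minMaxD X x y := by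
  refine Real.sInf_nonneg ?_
  rintro r ⟨p, -, -, -, -, -, rfl⟩
  exact pathCost_nonneg p

lemma minMaxD_le {X : Finset P} {D : ℝ} {x y : P} (hD : 0 ≤ D) (hx : x ∈ X)
    (h : SLLinked X D x y) : minMaxD X x y ≤ D := by
  obtain ⟨p, hp⟩ := (thresholdGraph_reachable_iff.2 h).exists_isPath
  have hc : pathCost p.support ≤ D := by
    rw [pathCost_le_iff hD]
    exact p.isChain_adj_support.imp fun _ _ h => h.2.2.2
  refine (csInf_le ⟨0, ?_⟩ ?_).trans hc
  · rintro r ⟨p, -, -, -, -, -, rfl⟩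
    exact pathCost_nonneg p
  · refine ⟨p.support, by simp, hp.support_nodup, thresholdGraph_support_subset hx p, ?_, ?_, rfl⟩
    · rw [List.head?_eq_some_head p.support_ne_nil, p.head_support]
    · rw [List.getLast?_eq_some_getLast p.support_ne_nil, p.getLast_support]

lemma slLinked_minMaxD {X : Finset P} {x y : P} (hx : x ∈ X) (hy : y ∈ X) :
    SLLinked X (minMaxD X x y) x y := by
  have hne : { r | ∃ p : List P, p ≠ [] ∧ p.Nodup ∧ (∀ a ∈ p, a ∈ X) ∧
      p.head? = some x ∧ p.getLast? = some y ∧ r = pathCost p }.Nonempty := by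
    by_cases h : x = y
    · subst h
      exact ⟨_, [x], by simp, by simp, by simpa using hx, rfl, rfl, rfl⟩
    · exact ⟨_, [x, y], by simp, by simp [h], by simp [hx, hy], rfl, rfl, rfl⟩
  have hfin : { r | ∃ p : List P, p ≠ [] ∧ p.Nodup ∧ (∀ a ∈ p, a ∈ X) ∧
      p.head? = some x ∧ p.getLast? = some y ∧ r = pathCost p }.Finite := by
    refine (Finset.finite_toSet
      (insert (0 : ℝ) ((X ×ˢ X).image fun q => dist q.1 q.2))).subset ?_
    rintro r ⟨p, -, -, hp, -, -, rfl⟩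
    exact pathCost_mem p hp
  obtain ⟨p, hp, -, hpX, hhead, hlast, hcost⟩ := hne.csInf_mem hfin
  change minMaxD X x y = pathCost p at hcost
  have hchain := (pathCost_le_iff (minMaxD_nonneg X x y) p).1 hcost.ge
  have hchain' : p.IsChain (SLStep X (minMaxD X x y)) :=
    hchain.imp_of_mem_imp fun a b ha hb h => ⟨hpX a ha, hpX b hb, h⟩
  have := List.relationReflTransGen_of_exists_isChain p hchain' hp
  rw [List.head?_eq_some_head hp, Option.some_inj] at hhead
  rw [List.getLast?_eq_some_getLast hp, Option.some_inj] at hlast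
  rwa [hhead, hlast] at this

lemma minMaxSet_nonneg (X : Finset P) (S : Set P) : 0 ≤ minMaxSet X S := by
  refine Real.sSup_nonneg ?_
  rintro r ⟨x, -, y, -, rfl⟩
  exact minMaxD_nonneg X x y

lemma minMaxD_le_minMaxSet {X : Finset P} {S : Set P} (hS : S ⊆ X) {x y : P} (hx : x ∈ S)
    (hy : y ∈ S) : minMaxD X x y ≤ minMaxSet X S := by
  refine le_csSup (Set.Finite.bddAbove ?_) ⟨x, hx, y, hy, rfl⟩
  have hf : S.Finite := X.finite_toSet.subset hS
  refine ((hf.prod hf).image fun q => minMaxD X q.1 q.2).subset ?_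
  rintro r ⟨x, hx, y, hy, rfl⟩
  exact ⟨(x, y), ⟨hx, hy⟩, rfl⟩

lemma minMaxSet_le {X : Finset P} {S : Set P} {D : ℝ} (hD : 0 ≤ D)
    (h : ∀ x ∈ S, ∀ y ∈ S, minMaxD X x y ≤ D) : minMaxSet X S ≤ D := by
  refine Real.sSup_le ?_ hD
  rintro r ⟨x, hx, y, hy, rfl⟩
  exact h x hx y hy

lemma mergeDist_nonneg (X : Finset P) (i : ℕ) : 0 ≤ mergeDist X i := by
  cases i with
  | zero => simp [mergeDist]
  | succ i =>
    rw [mergeDist]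
    refine Real.sInf_nonneg ?_
    rintro r ⟨x, -, y, -, -, rfl⟩
    exact dist_nonneg

lemma eq_of_mem_clustersAt {X : Finset P} {D : ℝ} {A : Set P} (hA : A ∈ clustersAt X D) {x : P}
    (hx : x ∈ A) : A = { y | y ∈ X ∧ SLLinked X D x y } := by
  obtain ⟨a, -, rfl⟩ := hA
  ext y
  exact and_congr_right fun _ =>
    ⟨fun h => hx.2.symm.trans h, fun h => hx.2.trans h⟩

lemma subset_of_mem_clustersAt {X : Finset P} {D : ℝ} {A : Set P} (hA : A ∈ clustersAt X D) :
    A ⊆ X := by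
  obtain ⟨a, -, rfl⟩ := hA
  exact fun y hy => hy.1

lemma exists_eq_of_mem_SLClusters {X : Finset P} {k : ℕ} {A : Set P} (hA : A ∈ SLClusters X k) :
    ∃ D, 0 ≤ D ∧ A ∈ clustersAt X D ∧ (clustersAt X D).ncard = k := by
  unfold SLClusters at hA
  split_ifs at hA with h
  · exact ⟨_, mergeDist_nonneg _ _, hA, Nat.find_spec h⟩
  · exact hA.elim

/-- If the clusters of `S` at threshold `D` are at least as many as the members of a cover of `S`
and one cluster lies in no member of the cover, then some member is split. -/
lemma exists_not_slLinked {S : Finset P} {D : ℝ} {k : ℕ} {C : Fin k → Set P}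
    (hcov : ∀ x ∈ S, ∃ j, x ∈ C j) (hcard : (clustersAt S D).ncard = k)
    {A : Set P} (hA : A ∈ clustersAt S D) (hAC : ∀ j, ¬ A ⊆ C j) :
    (∃ i j, i ≠ j ∧ ∃ x ∈ C i, ∃ y ∈ C j, x ∈ S ∧ SLLinked S D x y) ∧
    ∃ j, ∃ x ∈ S, ∃ y ∈ S, x ∈ C j ∧ y ∈ C j ∧ ¬ SLLinked S D x y := by
  obtain ⟨x, hxS, hAx⟩ := hA
  have hxA : x ∈ A := hAx ▸ ⟨hxS, .refl⟩
  obtain ⟨i, hi⟩ := hcov x hxS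
  obtain ⟨y, hyA, hyi⟩ := Set.not_subset.1 (hAC i)
  have hy : y ∈ S ∧ SLLinked S D x y := by rw [hAx] at hyA; exact hyA
  obtain ⟨j, hj⟩ := hcov y hy.1
  have hij : i ≠ j := by rintro rfl; exact hyi hj
  refine ⟨⟨i, j, hij, x, hi, y, hj, hxS, hy.2⟩, ?_⟩
  by_contra! hcon
  let g : Fin k → Set P := fun j => { z | z ∈ S ∧ ∃ w ∈ C j, w ∈ S ∧ SLLinked S D w z }
  have hg : ∀ l, ∀ w ∈ S, w ∈ C l → g l = { z | z ∈ S ∧ SLLinked S D w z } := by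
    intro l w hw hwl
    ext z
    refine and_congr_right fun hz => ⟨?_, fun h => ⟨w, hwl, hw, h⟩⟩
    rintro ⟨v, hvl, hv, hvz⟩
    exact (hcon l w hw v hv hwl hvl).trans hvz
  have hgij : g j = g i := by
    rw [hg i x hxS hi, hg j y hy.1 hj]
    ext z
    exact and_congr_right fun _ => ⟨fun h => hy.2.trans h, fun h => hy.2.symm.trans h⟩
  have hsub : clustersAt S D ⊆ ((Finset.univ.erase j).image g : Finset (Set P)) := by
    rintro B ⟨w, hw, rfl⟩
    obtain ⟨l, hl⟩ := hcov w hw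
    rw [← hg l w hw hl]
    simp only [Finset.coe_image, Set.mem_image, Finset.mem_coe, Finset.mem_erase,
      Finset.mem_univ, and_true]
    by_cases hlj : l = j
    · exact ⟨i, hij, by rw [hlj, hgij]⟩
    · exact ⟨l, hlj, rfl⟩
  have h1 := Set.ncard_le_ncard hsub (Finset.finite_toSet _)
  rw [hcard, Set.ncard_coe_finset] at h1
  have h2 := h1.trans Finset.card_image_le
  rw [Finset.card_erase_of_mem (Finset.mem_univ _), Finset.card_univ, Fintype.card_fin] at h2
  have := j.pos
  omega

/-- The points of `X` strictly closer, in the threshold graph, to each of `x` and `y` than these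
two points are to each other. -/
def between (X : Finset P) (D : ℝ) (x y : P) : Finset P :=
  X.filter fun z => (thresholdGraph X D).Reachable x z ∧ (thresholdGraph X D).Reachable z y ∧
    (thresholdGraph X D).dist x z < (thresholdGraph X D).dist x y ∧
    (thresholdGraph X D).dist z y < (thresholdGraph X D).dist x y

lemma dist_le_card_between {X : Finset P} {D : ℝ} {x y : P} (hx : x ∈ X)
    (h : (thresholdGraph X D).Reachable x y) :
    (thresholdGraph X D).dist x y ≤ (between X D x y).card + 1 := by
  obtain ⟨p, hp⟩ := h.exists_walk_length_eq_dist
  have key : ∀ i ≤ p.length, (thresholdGraph X D).dist x (p.getVert i) = i ∧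
      (thresholdGraph X D).dist (p.getVert i) y = p.length - i := by
    intro i hi
    have h1 := SimpleGraph.dist_le (p.take i)
    have h2 := SimpleGraph.dist_le (p.drop i)
    rw [SimpleGraph.Walk.take_length] at h1
    rw [SimpleGraph.Walk.drop_length] at h2
    have h3 := (p.take i).reachable.dist_triangle_left y
    have h4 := min_le_left i p.length
    omega
  have hinj : Set.InjOn p.getVert (Finset.Ioo 0 p.length) := by
    intro i hi j hj hij
    have hi' := (key i (Finset.mem_Ioo.1 hi).2.le).1
    rw [hij, (key j (Finset.mem_Ioo.1 hj).2.le).1] at hi'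
    exact hi'.symm
  have hsub : (Finset.Ioo 0 p.length).image p.getVert ⊆ between X D x y := by
    intro z hz
    obtain ⟨i, hi, rfl⟩ := Finset.mem_image.1 hz
    have hi' := Finset.mem_Ioo.1 hi
    have hk := key i hi'.2.le
    refine Finset.mem_filter.2 ⟨thresholdGraph_support_subset hx p _ (p.getVert_mem_support i),
      (p.take i).reachable, (p.drop i).reachable, ?_, ?_⟩ <;> omega
  have := Finset.card_le_card hsub
  rw [Finset.card_image_of_injOn hinj, Nat.card_Ioo] at this
  omega

/-- If a sample `S` splits a cluster of `X`, then it misses all points between two points that are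
linked in `X` but not in `S`. -/
lemma exists_disjoint_between {X S : Finset P} {D E : ℝ} {x y : P} (hx : x ∈ S) (hy : y ∈ S)
    (hxy : (thresholdGraph X D).Reachable x y) (hS : ¬ SLLinked S E x y) :
    ∃ a ∈ S, ∃ b ∈ S, (thresholdGraph X D).Reachable a b ∧ ¬ SLLinked S E a b ∧
      Disjoint S (between X D a b) := by
  induction hN : (thresholdGraph X D).dist x y using Nat.strong_induction_on generalizing x y with
  | _ N ih =>
  subst hN
  by_cases hd : Disjoint S (between X D x y)
  · exact ⟨x, hx, y, hy, hxy, hS, hd⟩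
  obtain ⟨z, hz, hzb⟩ := Finset.not_disjoint_iff.1 hd
  obtain ⟨-, hxz, hzy, h1, h2⟩ := Finset.mem_filter.1 hzb
  by_cases hl : SLLinked S E x z
  · exact ih _ h2 hz hy hzy (fun h => hS (hl.trans h)) rfl
  · exact ih _ h1 hx hz hxz hl rfl

lemma le_card_between {X S : Finset P} {D E β : ℝ} (hD : 0 < D) (hβ : β ≤ E) (hSX : S ⊆ X)
    {a b : P} (ha : a ∈ S) (hb : b ∈ S)
    (hab : (thresholdGraph X D).Reachable a b) (hS : ¬ SLLinked S E a b) :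
    ⌈(β - D) / D⌉ ≤ ((between X D a b).card : ℤ) := by
  have h1 : E < dist a b := by
    by_contra! h
    exact hS (.single ha hb h)
  obtain ⟨p, hp⟩ := hab.exists_walk_length_eq_dist
  have h2 := thresholdGraph_dist_le p
  have h3 : (p.length : ℝ) ≤ (between X D a b).card + 1 := by
    rw [hp]
    exact_mod_cast dist_le_card_between (hSX ha) hab
  rw [Int.ceil_le, div_le_iff₀ hD]
  push_cast
  nlinarith [mul_le_mul_of_nonneg_right h3 hD.le]

lemma unifProb_eq_ncard {α : Type*} [Fintype α] (E : Set α) :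
    unifProb E = (E.ncard : ℝ) / Fintype.card α := by
  unfold unifProb
  rw [← Set.ncard_coe_finset, Finset.coe_filter_univ]
  rfl

lemma unifProb_le_one {α : Type*} [Fintype α] (E : Set α) : unifProb E ≤ 1 := by
  unfold unifProb
  exact div_le_one_of_le₀ (by exact_mod_cast Finset.card_le_univ _) (by positivity)

lemma unifProb_mono {α : Type*} [Fintype α] {E F : Set α} (h : E ⊆ F) :
    unifProb E ≤ unifProb F := by
  unfold unifProb
  gcongr

lemma unifProb_biUnion_le {α ι : Type*} [Fintype α] (s : Finset ι) (E : ι → Set α) :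
    unifProb (⋃ i ∈ s, E i) ≤ ∑ i ∈ s, unifProb (E i) := by
  unfold unifProb
  rw [← Finset.sum_div]
  gcongr
  rw [← Nat.cast_sum, Nat.cast_le]
  refine (Finset.card_le_card ?_).trans Finset.card_biUnion_le
  intro a ha
  simpa using ha

lemma unifProb_disjoint_sampleFinset_le {α : Type*} {X B : Finset α} (hB : B ⊆ X) (hX : X.Nonempty) (m : ℕ) :
    unifProb { ω : Fin m → {x // x ∈ X} | Disjoint (sampleFinset X ω) B } ≤
      Real.exp (-(m * (B.card / X.card : ℝ))) := by
  have hX0 : (0 : ℝ) < X.card := by exact_mod_cast hX.card_pos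
  have hset : { ω : Fin m → {x // x ∈ X} | Disjoint (sampleFinset X ω) B } =
      ↑(Fintype.piFinset fun _ : Fin m =>
        Finset.univ.filter fun x : {x // x ∈ X} => (x : α) ∉ B) := by
    ext ω
    simp [sampleFinset, Finset.disjoint_left]
  have hcard : (Finset.univ.filter fun x : {x // x ∈ X} => (x : α) ∉ B).card =
      X.card - B.card := by
    rw [← Finset.card_sdiff_of_subset hB, ← Finset.card_map (Function.Embedding.subtype _)]
    congr 1
    ext x
    simp [and_comm]
  rw [unifProb_eq_ncard, hset, Set.ncard_coe_finset, Fintype.card_piFinset_const]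
  rw [hcard, Fintype.card_fun, Fintype.card_coe, Fintype.card_fin, Nat.cast_pow, Nat.cast_pow,
    Nat.cast_sub (Finset.card_le_card hB), ← div_pow, sub_div, div_self hX0.ne',
    ← mul_neg, Real.exp_nat_mul]
  refine pow_le_pow_left₀ ?_ (Real.one_sub_le_exp_neg _) m
  rw [sub_nonneg, div_le_one hX0]
  exact_mod_cast Finset.card_le_card hB

lemma unifProb_exists_disjoint_between_le {X : Finset P} (hX : X.Nonempty) (D : ℝ) (s m : ℕ) :
    unifProb { ω : Fin m → {x // x ∈ X} | ∃ a ∈ X, ∃ b ∈ X, s ≤ (between X D a b).card ∧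
        Disjoint (sampleFinset X ω) (between X D a b) } ≤
      (X.card : ℝ) ^ 2 * Real.exp (-(m * (s / X.card : ℝ))) := by
  let T := (X ×ˢ X).filter fun q => s ≤ (between X D q.1 q.2).card
  calc _ ≤ unifProb (⋃ q ∈ T, { ω : Fin m → {x // x ∈ X} |
        Disjoint (sampleFinset X ω) (between X D q.1 q.2) }) := by
        refine unifProb_mono ?_
        rintro ω ⟨a, ha, b, hb, hs, hd⟩
        simp only [Set.mem_iUnion]
        exact ⟨(a, b), Finset.mem_filter.2 ⟨Finset.mem_product.2 ⟨ha, hb⟩, hs⟩, hd⟩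
    _ ≤ ∑ q ∈ T, Real.exp (-(m * (s / X.card : ℝ))) := by
        refine (unifProb_biUnion_le _ _).trans (Finset.sum_le_sum fun q hq => ?_)
        refine (unifProb_disjoint_sampleFinset_le (Finset.filter_subset _ _) hX m).trans ?_
        have : (s : ℝ) ≤ (between X D q.1 q.2).card :=
          Nat.cast_le.2 (Finset.mem_filter.1 hq).2
        exact Real.exp_le_exp.2 (neg_le_neg (mul_le_mul_of_nonneg_left
          (div_le_div_of_nonneg_right this (Nat.cast_nonneg _)) (Nat.cast_nonneg _)))
    _ ≤ _ := by
        rw [Finset.sum_const, nsmul_eq_mul]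
        gcongr
        have : T.card ≤ X.card * X.card :=
          (Finset.card_filter_le _ _).trans (Finset.card_product _ _).le
        rw [sq]
        exact_mod_cast this

lemma sampleFinset_subset {α : Type*} {m : ℕ} (X : Finset α) (ω : Fin m → {x // x ∈ X}) :
    sampleFinset X ω ⊆ X := by
  intro x hx
  obtain ⟨i, -, rfl⟩ := Finset.mem_image.1 hx
  exact (ω i).2

/-- A threshold linking two different clusters is at least the bottleneck separation. -/
lemma sInf_minMaxSet_le {X : Finset P} {D E : ℝ} {k : ℕ} {C : Fin k → Set P}
    (hinj : Function.Injective C) (hC : ∀ j, C j ∈ clustersAt X D) (hE : 0 ≤ E)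
    {i j : Fin k} (hij : i ≠ j) {x y : P} (hx : x ∈ C i) (hy : y ∈ C j) (h : SLLinked X E x y) :
    sInf { r | ∃ i j : Fin k, i ≠ j ∧ r = minMaxSet X (C i ∪ C j) } ≤ E := by
  have hDE : D ≤ E := by
    by_contra! hlt
    have hxi := eq_of_mem_clustersAt (hC i) hx
    have hyi : y ∈ C i := by
      rw [hxi]
      exact ⟨subset_of_mem_clustersAt (hC j) hy, h.mono subset_rfl hlt.le⟩
    exact hij (hinj ((eq_of_mem_clustersAt (hC i) hyi).trans
      (eq_of_mem_clustersAt (hC j) hy).symm))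
  have hbdd : BddBelow { r | ∃ i j : Fin k, i ≠ j ∧ r = minMaxSet X (C i ∪ C j) } := by
    refine ⟨0, ?_⟩
    rintro r ⟨i, j, -, rfl⟩
    exact minMaxSet_nonneg _ _
  refine (csInf_le hbdd ⟨i, j, hij, rfl⟩).trans ?_
  have hlink : ∀ z ∈ C i ∪ C j, SLLinked X E x z := by
    rintro z (hz | hz)
    · rw [eq_of_mem_clustersAt (hC i) hx] at hz
      exact hz.2.mono subset_rfl hDE
    · rw [eq_of_mem_clustersAt (hC j) hy] at hz
      exact h.trans (hz.2.mono subset_rfl hDE)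
  refine minMaxSet_le hE fun u hu v hv => minMaxD_le hE ?_ ((hlink u hu).symm.trans (hlink v hv))
  rcases hu with hu | hu
  · exact subset_of_mem_clustersAt (hC i) hu
  · exact subset_of_mem_clustersAt (hC j) hu

end SingleLinkage

/-- Let `C = SingleLinkage(X,k)` and `C′ = SingleLinkage(X_m,k)` for a random
subsample `X_m` of `m` points drawn uniformly with replacement from `X`.  The probability that
`C′` is inconsistent with `C` (some `C′_i` is contained in no `C_j`) is at most
`(kn)³·exp(−m/(n·ζ_{k,SL}(X)))`. -/
theorem stmt9 {d : ℕ} (X : Finset (EuclideanSpace ℝ (Fin d))) (n : ℕ) (hn : X.card = n)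
    (k : ℕ) (hk : 0 < k) (C : Fin k → Set (EuclideanSpace ℝ (Fin d)))
    (hinj : Function.Injective C) (hC : IsSLClustering X k (Set.range C)) (m : ℕ) :
    unifProb { ω : Fin m → {x // x ∈ X} |
        ∃ C' ∈ SLClusters (sampleFinset X ω) k, ∀ j : Fin k, ¬ C' ⊆ C j } ≤
      ((k * n : ℕ) : ℝ) ^ 3 * Real.exp (-(m : ℝ) / ((n : ℝ) * zetaSL X C)) := by
  obtain ⟨ℓ, hCℓ, -⟩ := hC
  have hCj : ∀ j, C j ∈ clustersAt X (mergeDist X ℓ) := fun j => hCℓ ▸ Set.mem_range_self j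
  have hX : X.Nonempty := by
    obtain ⟨x, hx, -⟩ := hCj ⟨0, hk⟩
    exact ⟨x, hx⟩
  have hn1 : 1 ≤ n := hn ▸ hX.card_pos
  have hnR : (1 : ℝ) ≤ n := by exact_mod_cast hn1
  have hkR : (1 : ℝ) ≤ k := by exact_mod_cast hk
  unfold zetaSL
  set D := sSup { r | ∃ t : Fin k, r = minMaxSet X (C t) } with hD
  set β := sInf { r | ∃ i j : Fin k, i ≠ j ∧ r = minMaxSet X (C i ∪ C j) } with hβ
  rw [hn]
  have hexp : -(m : ℝ) / ((n : ℝ) * ((n : ℝ) * ((⌈(β - D) / D⌉ : ℝ))⁻¹)) =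
      -(m * ((⌈(β - D) / D⌉ : ℝ) / n)) / n := by
    field_simp
  rw [hexp]
  have hD0 : 0 ≤ D := by
    refine Real.sSup_nonneg ?_
    rintro r ⟨t, rfl⟩
    exact minMaxSet_nonneg _ _
  rcases le_or_gt ⌈(β - D) / D⌉ 0 with hs | hs
  · refine (unifProb_le_one _).trans (one_le_mul_of_one_le_of_one_le ?_ (Real.one_le_exp ?_))
    · exact one_le_pow₀ (by push_cast; nlinarith)
    · have hsR : (⌈(β - D) / D⌉ : ℝ) ≤ 0 := by exact_mod_cast hs
      refine div_nonneg (neg_nonneg.2 (mul_nonpos_of_nonneg_of_nonpos (by positivity) ?_))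
        (by positivity)
      exact div_nonpos_of_nonpos_of_nonneg hsR (by positivity)
  have hDpos : 0 < D := by
    refine lt_of_le_of_ne hD0 fun h => ?_
    rw [← h] at hs
    simp at hs
  obtain ⟨s, hsN⟩ := Int.eq_ofNat_of_zero_le hs.le
  have hlinked : ∀ j, ∀ x ∈ C j, ∀ y ∈ C j, SLLinked X D x y := by
    intro j x hx y hy
    have hCX := subset_of_mem_clustersAt (hCj j)
    refine (slLinked_minMaxD (hCX hx) (hCX hy)).mono subset_rfl ?_
    refine (minMaxD_le_minMaxSet hCX hx hy).trans (le_csSup (Set.Finite.bddAbove ?_) ⟨j, rfl⟩)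
    refine (Set.finite_range fun t => minMaxSet X (C t)).subset ?_
    rintro r ⟨t, rfl⟩
    exact ⟨t, rfl⟩
  have hcov : ∀ x ∈ X, ∃ j, x ∈ C j := by
    intro x hx
    have hmem : { y | y ∈ X ∧ SLLinked X (mergeDist X ℓ) x y } ∈ Set.range C :=
      hCℓ ▸ ⟨x, hx, rfl⟩
    obtain ⟨j, hj⟩ := hmem
    exact ⟨j, hj ▸ ⟨hx, .refl⟩⟩
  have hmain := unifProb_exists_disjoint_between_le hX D s m
  rw [hn] at hmain
  refine (unifProb_mono ?_).trans (hmain.trans (mul_le_mul ?_ ?_ (by positivity) (by positivity)))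
  · rintro ω ⟨A, hA, hAC⟩
    obtain ⟨E, hE, hAE, hcard⟩ := exists_eq_of_mem_SLClusters hA
    have hSX := sampleFinset_subset X ω
    obtain ⟨⟨i, j, hij, x, hx, y, hy, -, hxy⟩, l, u, hu, v, hv, hul, hvl, huv⟩ :=
      exists_not_slLinked (fun x hx => hcov x (hSX hx)) hcard hAE hAC
    have hβE : β ≤ E := sInf_minMaxSet_le hinj hCj hE hij hx hy (hxy.mono hSX le_rfl)
    obtain ⟨a, ha, b, hb, hab, hnab, hdis⟩ := exists_disjoint_between hu hv
      (thresholdGraph_reachable_iff.2 (hlinked l u hul v hvl)) huv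
    refine ⟨a, hSX ha, b, hSX hb, ?_, hdis⟩
    have := le_card_between hDpos hβE hSX ha hb hab hnab
    rw [hsN] at this
    exact_mod_cast this
  · calc (n : ℝ) ^ 2 ≤ (n : ℝ) ^ 3 := pow_le_pow_right₀ hnR (by norm_num)
      _ ≤ ((k * n : ℕ) : ℝ) ^ 3 := by
        gcongr
        exact Nat.le_mul_of_pos_left n hk
  · rw [hsN, Int.cast_natCast, neg_div]
    gcongr
    exact div_le_self (by positivity) hnR
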